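/- Assume the Lr (a,τ) interval exchange transformation T is irreducible and satisfies the Keane Condition. If α ≠ β are points of X, then the pair {α, β} is negatively asymptotic if and only if there exist i ∈ {1,…,n−1} and k ∈ ℤ such that, with x = b_i ∈ D, {α, β} = {S^k 𝓘(x), S^k 𝓘̃(x)}. -/

import Mathlib

open Set

noncomputable section

/-- `bpt a k = a_1 + ⋯ + a_k` (0-indexed: the sum of the first `k` entries of `a`);
these are the division points `b_k` of the interval exchange. -/
def bpt {n : ℕ} (a : Fin n → ℝ) (k : ℕ) : ℝ :=
  ∑ j ∈ Finset.univ.filter (fun j : Fin n => (j : ℕ) < k), a j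

/-- The left-closed right-open interval `J_i = [b_{i-1}, b_i)` (0-indexed). -/
def Jint {n : ℕ} (a : Fin n → ℝ) (i : Fin n) : Set ℝ :=
  Set.Ico (bpt a (i : ℕ)) (bpt a ((i : ℕ) + 1))

/-- The left-open right-closed interval `J̃_i = (b_{i-1}, b_i]` (0-indexed). -/
def Jtil {n : ℕ} (a : Fin n → ℝ) (i : Fin n) : Set ℝ :=
  Set.Ioc (bpt a (i : ℕ)) (bpt a ((i : ℕ) + 1))

/-- The permuted probability vector `a^τ`, with `a^τ_{τ(i)} = a_i`. -/
def aperm {n : ℕ} (a : Fin n → ℝ) (τ : Equiv.Perm (Fin n)) : Fin n → ℝ :=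
  fun j => a (τ.symm j)

/-- The set `D = {b_1, …, b_{n-1}}` of interior division points. -/
def Dset {n : ℕ} (a : Fin n → ℝ) : Set ℝ :=
  {x | ∃ k : ℕ, 0 < k ∧ k < n ∧ x = bpt a k}

/-- `a` is a positive probability vector. -/
def IsProbVec {n : ℕ} (a : Fin n → ℝ) : Prop :=
  (∀ i, 0 < a i) ∧ ∑ i, a i = 1

/-- `T` is the Lr `(a,τ)` interval exchange transformation: on each
`J_i = [b_{i-1}, b_i)` it is the translation `x ↦ x - b_{i-1} + b^τ_{τ(i)-1}`. -/
def IsLrIET {n : ℕ} (a : Fin n → ℝ) (τ : Equiv.Perm (Fin n)) (T : ℝ → ℝ) : Prop :=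
  ∀ i : Fin n, ∀ x ∈ Jint a i, T x = x - bpt a (i : ℕ) + bpt (aperm a τ) ((τ i : ℕ))

/-- `Tt` is the dual lR `(a,τ)` interval exchange transformation: on each
`J̃_i = (b_{i-1}, b_i]` it is the translation `x ↦ x - b_{i-1} + b^τ_{τ(i)-1}`. -/
def IslRIET {n : ℕ} (a : Fin n → ℝ) (τ : Equiv.Perm (Fin n)) (Tt : ℝ → ℝ) : Prop :=
  ∀ i : Fin n, ∀ x ∈ Jtil a i, Tt x = x - bpt a (i : ℕ) + bpt (aperm a τ) ((τ i : ℕ))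

/-- The Keane Condition: `D ∩ T^k(D) = ∅` for every positive integer `k`. -/
def KeaneCond {n : ℕ} (a : Fin n → ℝ) (T : ℝ → ℝ) : Prop :=
  ∀ k : ℕ, 0 < k → Dset a ∩ (T^[k] '' Dset a) = ∅

/-- `τ` is irreducible: `τ({1,…,j}) ≠ {1,…,j}` for `j = 1, …, n-1` (0-indexed:
no proper initial segment is invariant). -/
def IrreduciblePerm {n : ℕ} (τ : Equiv.Perm (Fin n)) : Prop :=
  ∀ j : ℕ, 0 < j → j < n →
    (fun i => τ i) '' {i : Fin n | (i : ℕ) < j} ≠ {i : Fin n | (i : ℕ) < j}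

/-- `P` is the family of ℤ-iterates of `T` on `[0,1)`: `P 0 = id`,
`P (k+1) = T ∘ P k`, and each `P k` maps `[0,1)` into itself. -/
def IsZIterLr (T : ℝ → ℝ) (P : ℤ → ℝ → ℝ) : Prop :=
  (∀ x ∈ Set.Ico (0 : ℝ) 1, P 0 x = x) ∧
  ∀ k : ℤ, ∀ x ∈ Set.Ico (0 : ℝ) 1, P k x ∈ Set.Ico (0 : ℝ) 1 ∧ P (k + 1) x = T (P k x)

/-- `Pt` is the family of ℤ-iterates of `Tt` on `(0,1]`. -/
def IsZIterlR (Tt : ℝ → ℝ) (Pt : ℤ → ℝ → ℝ) : Prop :=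
  (∀ x ∈ Set.Ioc (0 : ℝ) 1, Pt 0 x = x) ∧
  ∀ k : ℤ, ∀ x ∈ Set.Ioc (0 : ℝ) 1, Pt k x ∈ Set.Ioc (0 : ℝ) 1 ∧ Pt (k + 1) x = Tt (Pt k x)

/-- `I` is the itinerary map of `T` (with ℤ-iterates `P`):
`𝓘(x)_k = i ↔ T^k x ∈ J_i` for `x ∈ [0,1)`. -/
def IsItin {n : ℕ} (a : Fin n → ℝ) (P : ℤ → ℝ → ℝ) (I : ℝ → ℤ → Fin n) : Prop :=
  ∀ x ∈ Set.Ico (0 : ℝ) 1, ∀ k : ℤ, ∀ i : Fin n, (I x k = i ↔ P k x ∈ Jint a i)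

/-- `It` is the itinerary map of `Tt` (with ℤ-iterates `Pt`):
`𝓘̃(x)_k = i ↔ T̃^k x ∈ J̃_i` for `x ∈ (0,1]`. -/
def IsItinDual {n : ℕ} (a : Fin n → ℝ) (Pt : ℤ → ℝ → ℝ) (It : ℝ → ℤ → Fin n) : Prop :=
  ∀ x ∈ Set.Ioc (0 : ℝ) 1, ∀ k : ℤ, ∀ i : Fin n, (It x k = i ↔ Pt k x ∈ Jtil a i)

/-- `D_∞ = {0,1} ∪ ⋃_{k ∈ ℤ} T^k(D)`. -/
def Dinf {n : ℕ} (a : Fin n → ℝ) (P : ℤ → ℝ → ℝ) : Set ℝ :=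
  {0, 1} ∪ ⋃ k : ℤ, P k '' Dset a

/-- The set `R = [0,1] ∖ D_∞` of regular points. -/
def Rset {n : ℕ} (a : Fin n → ℝ) (P : ℤ → ℝ → ℝ) : Set ℝ :=
  Set.Icc 0 1 \ Dinf a P

/-- The shift `S` on `Ω = {1,…,n}^ℤ`: `S(α)_i = α_{i+1}`. -/
def shiftS {n : ℕ} (α : ℤ → Fin n) : ℤ → Fin n := fun i => α (i + 1)

/-- The `k`-th power of the shift: `(S^k α)_i = α_{i+k}`. -/
def shiftZ {n : ℕ} (k : ℤ) (α : ℤ → Fin n) : ℤ → Fin n := fun i => α (i + k)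

/-- `α, β` are positively asymptotic: `α_i = β_i` for all `i ≥ N`, some `N`. -/
def PosAsymp {n : ℕ} (α β : ℤ → Fin n) : Prop :=
  ∃ N : ℕ, ∀ i : ℤ, (N : ℤ) ≤ i → α i = β i

/-- `α, β` are negatively asymptotic: `α_i = β_i` for all `i ≤ -N`, some `N`. -/
def NegAsymp {n : ℕ} (α β : ℤ → Fin n) : Prop :=
  ∃ N : ℕ, ∀ i : ℤ, i ≤ -(N : ℤ) → α i = β i

section Coding

open Filter Topology

variable {n : ℕ} {a : Fin n → ℝ} {τ : Equiv.Perm (Fin n)} {T Tt : ℝ → ℝ}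
  {P Pt : ℤ → ℝ → ℝ} {I It : ℝ → ℤ → Fin n}

lemma bpt_zero (a : Fin n → ℝ) : bpt a 0 = 0 := by simp [bpt]

lemma bpt_total (ha : IsProbVec a) : bpt a n = 1 := by
  rw [← ha.2, bpt]
  congr 1
  ext j
  simp

lemma bpt_succ (a : Fin n → ℝ) (i : Fin n) : bpt a ((i : ℕ) + 1) = bpt a i + a i := by
  have h : Finset.univ.filter (fun j : Fin n => (j : ℕ) < (i : ℕ) + 1)
      = insert i (Finset.univ.filter (fun j : Fin n => (j : ℕ) < (i : ℕ))) := by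
    ext j
    simp only [Finset.mem_filter, Finset.mem_univ, true_and, Finset.mem_insert, Fin.ext_iff]
    omega
  rw [bpt, h, Finset.sum_insert (by simp), bpt, add_comm]

lemma bpt_mono (ha : ∀ i, 0 < a i) : Monotone (bpt a) := by
  intro k l hkl
  refine Finset.sum_le_sum_of_subset_of_nonneg ?_ fun i _ _ => (ha i).le
  intro j hj
  simp only [Finset.mem_filter, Finset.mem_univ, true_and] at hj ⊢
  omega

lemma bpt_nonneg (ha : IsProbVec a) (k : ℕ) : 0 ≤ bpt a k :=
  bpt_zero a ▸ bpt_mono ha.1 k.zero_le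

lemma bpt_succ_le_one (ha : IsProbVec a) (i : Fin n) : bpt a ((i : ℕ) + 1) ≤ 1 :=
  bpt_total ha ▸ bpt_mono ha.1 i.isLt

/-- The division points `b_1, …, b_{n-1}` lie in the open unit interval. -/
lemma bpt_mem_Ioo (ha : IsProbVec a) {k : ℕ} (h0 : 0 < k) (hk : k < n) :
    bpt a k ∈ Ioo (0 : ℝ) 1 := by
  have h1 := bpt_succ a ⟨k, hk⟩
  have h2 := bpt_succ_le_one ha ⟨k, hk⟩
  have h3 := ha.1 ⟨k, hk⟩
  have h4 := bpt_succ a ⟨0, h0.trans hk⟩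
  have h5 := ha.1 ⟨0, h0.trans hk⟩
  have h6 : bpt a (0 + 1) ≤ bpt a k := bpt_mono ha.1 h0
  simp only [bpt_zero] at h1 h2 h3 h4 h5
  exact ⟨by linarith, by linarith⟩

lemma Jint_subset (ha : IsProbVec a) (i : Fin n) : Jint a i ⊆ Ico 0 1 := fun _ hx =>
  ⟨(bpt_nonneg ha _).trans hx.1, hx.2.trans_le (bpt_succ_le_one ha i)⟩

lemma Jtil_subset (ha : IsProbVec a) (i : Fin n) : Jtil a i ⊆ Ioc 0 1 := fun _ hx =>
  ⟨(bpt_nonneg ha _).trans_lt hx.1, hx.2.trans (bpt_succ_le_one ha i)⟩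

/-- The displacement of the interval exchange on its `i`-th interval. -/
def disp (a : Fin n → ℝ) (τ : Equiv.Perm (Fin n)) (i : Fin n) : ℝ :=
  bpt (aperm a τ) (τ i : ℕ) - bpt a (i : ℕ)

lemma IsLrIET.apply (hT : IsLrIET a τ T) {i : Fin n} {x : ℝ} (hx : x ∈ Jint a i) :
    T x = x + disp a τ i := by
  rw [hT i x hx, disp]; ring

lemma IslRIET.apply (hTt : IslRIET a τ Tt) {i : Fin n} {x : ℝ} (hx : x ∈ Jtil a i) :
    Tt x = x + disp a τ i := by
  rw [hTt i x hx, disp]; ring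

lemma image_separated (ha : IsProbVec a) (τ : Equiv.Perm (Fin n)) {i j : Fin n} (hij : i ≠ j) :
    bpt a ((i : ℕ) + 1) + disp a τ i ≤ bpt a j + disp a τ j ∨
      bpt a ((j : ℕ) + 1) + disp a τ j ≤ bpt a i + disp a τ i := by
  have hm : Monotone (bpt (aperm a τ)) := bpt_mono fun i => ha.1 _
  have hs : ∀ i, bpt (aperm a τ) ((τ i : ℕ) + 1) = bpt (aperm a τ) (τ i) + a i := fun i => by
    rw [bpt_succ, aperm, Equiv.symm_apply_apply]
  simp only [disp, bpt_succ]
  rcases lt_or_gt_of_ne (fun h => hij (τ.injective (Fin.ext h)) : (τ i : ℕ) ≠ τ j) with h | h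
  · left
    have := hm (Nat.succ_le_of_lt h)
    rw [Nat.succ_eq_add_one, hs] at this
    linarith
  · right
    have := hm (Nat.succ_le_of_lt h)
    rw [Nat.succ_eq_add_one, hs] at this
    linarith

lemma IsLrIET.inj (ha : IsProbVec a) (hT : IsLrIET a τ T) {i j : Fin n} {x y : ℝ}
    (hx : x ∈ Jint a i) (hy : y ∈ Jint a j) (h : T x = T y) : x = y := by
  rw [hT.apply hx, hT.apply hy] at h
  by_cases hij : i = j
  · subst hij; linarith
  · rcases image_separated ha τ hij with h' | h' <;> linarith [hx.1, hx.2, hy.1, hy.2]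

lemma IslRIET.inj (ha : IsProbVec a) (hTt : IslRIET a τ Tt) {i j : Fin n} {x y : ℝ}
    (hx : x ∈ Jtil a i) (hy : y ∈ Jtil a j) (h : Tt x = Tt y) : x = y := by
  rw [hTt.apply hx, hTt.apply hy] at h
  by_cases hij : i = j
  · subst hij; linarith
  · rcases image_separated ha τ hij with h' | h' <;> linarith [hx.1, hx.2, hy.1, hy.2]

lemma IsItin.mem (hI : IsItin a P I) {x : ℝ} (hx : x ∈ Ico (0 : ℝ) 1) (k : ℤ) :
    P k x ∈ Jint a (I x k) :=
  (hI x hx k _).1 rfl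

lemma IsItinDual.mem (hIt : IsItinDual a Pt It) {x : ℝ} (hx : x ∈ Ioc (0 : ℝ) 1) (k : ℤ) :
    Pt k x ∈ Jtil a (It x k) :=
  (hIt x hx k _).1 rfl

lemma exists_mem_Jint (hP : IsZIterLr T P) (hI : IsItin a P I) {x : ℝ}
    (hx : x ∈ Ico (0 : ℝ) 1) : ∃ i, x ∈ Jint a i :=
  ⟨I x 0, by simpa [hP.1 x hx] using hI.mem hx 0⟩

lemma exists_mem_Jtil (hPt : IsZIterlR Tt Pt) (hIt : IsItinDual a Pt It) {x : ℝ}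
    (hx : x ∈ Ioc (0 : ℝ) 1) : ∃ i, x ∈ Jtil a i :=
  ⟨It x 0, by simpa [hPt.1 x hx] using hIt.mem hx 0⟩

lemma injOn_Lr (ha : IsProbVec a) (hT : IsLrIET a τ T) (hP : IsZIterLr T P)
    (hI : IsItin a P I) : InjOn T (Ico 0 1) := fun _ hx _ hy h =>
  let ⟨_, hi⟩ := exists_mem_Jint hP hI hx
  let ⟨_, hj⟩ := exists_mem_Jint hP hI hy
  hT.inj ha hi hj h

lemma injOn_lR (ha : IsProbVec a) (hTt : IslRIET a τ Tt) (hPt : IsZIterlR Tt Pt)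
    (hIt : IsItinDual a Pt It) : InjOn Tt (Ioc 0 1) := fun _ hx _ hy h =>
  let ⟨_, hi⟩ := exists_mem_Jtil hPt hIt hx
  let ⟨_, hj⟩ := exists_mem_Jtil hPt hIt hy
  hTt.inj ha hi hj h

lemma mapsTo_Lr (hP : IsZIterLr T P) : MapsTo T (Ico 0 1) (Ico 0 1) := fun x hx => by
  have h := (hP.2 0 x hx).2
  rw [hP.1 x hx] at h
  exact h ▸ (hP.2 (0 + 1) x hx).1

/-- The `ℤ`-iterates of an injective map of a set into itself form a `ℤ`-action. -/
lemma zIter_add {S : Set ℝ} {f : ℝ → ℝ} {Q : ℤ → ℝ → ℝ} (hf : InjOn f S)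
    (h0 : ∀ x ∈ S, Q 0 x = x) (hQ : ∀ k : ℤ, ∀ x ∈ S, Q k x ∈ S ∧ Q (k + 1) x = f (Q k x))
    {x : ℝ} (hx : x ∈ S) (l m : ℤ) : Q l (Q m x) = Q (l + m) x := by
  have hm := (hQ m x hx).1
  induction l using Int.induction_on with
  | zero => rw [h0 _ hm, zero_add]
  | succ l ih =>
    rw [(hQ _ _ hm).2, ih, show (l : ℤ) + 1 + m = (l + m) + 1 by ring, (hQ _ _ hx).2]
  | pred l ih =>
    refine hf (hQ _ _ hm).1 (hQ _ _ hx).1 ?_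
    rw [← (hQ _ _ hm).2, ← (hQ _ _ hx).2, sub_add_cancel, ih]
    congr 1; ring

lemma itin_shift (ha : IsProbVec a) (hT : IsLrIET a τ T) (hP : IsZIterLr T P)
    (hI : IsItin a P I) {x : ℝ} (hx : x ∈ Ico (0 : ℝ) 1) (m : ℤ) :
    shiftZ (-m) (I (P m x)) = I x := by
  funext l
  rw [shiftZ, hI _ (hP.2 m x hx).1, zIter_add (injOn_Lr ha hT hP hI) hP.1 hP.2 hx,
    neg_add_cancel_right]
  exact hI.mem hx l

lemma itinDual_shift (ha : IsProbVec a) (hTt : IslRIET a τ Tt) (hPt : IsZIterlR Tt Pt)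
    (hIt : IsItinDual a Pt It) {x : ℝ} (hx : x ∈ Ioc (0 : ℝ) 1) (m : ℤ) :
    shiftZ (-m) (It (Pt m x)) = It x := by
  funext l
  rw [shiftZ, hIt _ (hPt.2 m x hx).1, zIter_add (injOn_lR ha hTt hPt hIt) hPt.1 hPt.2 hx,
    neg_add_cancel_right]
  exact hIt.mem hx l

/-- Every integer iterate of `T` is locally a translation to the right of each point. -/
lemma eventually_zIter_right (ha : IsProbVec a) (hT : IsLrIET a τ T) (hP : IsZIterLr T P)
    (hI : IsItin a P I) {x : ℝ} (hx : x ∈ Ico (0 : ℝ) 1) (k : ℤ) :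
    ∀ᶠ y in 𝓝[≥] x, y ∈ Ico (0 : ℝ) 1 ∧ P k y = P k x + (y - x) := by
  have hroom : ∀ k : ℤ, ∀ᶠ y in 𝓝[≥] x, P k x + (y - x) ∈ Jint a (I x k) := fun k => by
    have hk := hI.mem hx k
    have h1 : ∀ᶠ y in 𝓝[≥] x, y ∈ Ico x (x + (bpt a ((I x k : ℕ) + 1) - P k x)) :=
      Ico_mem_nhdsGE (by linarith [hk.2])
    filter_upwards [h1] with y hy
    exact ⟨by linarith [hk.1, hy.1], by linarith [hy.2]⟩
  induction k using Int.induction_on with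
  | zero =>
    filter_upwards [Ico_mem_nhdsGE hx.2] with y hy
    have : y ∈ Ico (0 : ℝ) 1 := ⟨hx.1.trans hy.1, hy.2⟩
    exact ⟨this, by rw [hP.1 _ this, hP.1 _ hx]; ring⟩
  | succ k ih =>
    filter_upwards [ih, hroom k] with y ⟨hy, h⟩ hr
    refine ⟨hy, ?_⟩
    rw [(hP.2 _ _ hy).2, (hP.2 _ _ hx).2, h, hT.apply hr, hT.apply (hI.mem hx _)]
    ring
  | pred k ih =>
    filter_upwards [ih, hroom (-k - 1)] with y ⟨hy, h⟩ hr
    refine ⟨hy, injOn_Lr ha hT hP hI (hP.2 _ _ hy).1 (Jint_subset ha _ hr) ?_⟩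
    rw [← (hP.2 _ _ hy).2, sub_add_cancel, h, hT.apply hr]
    have := (hP.2 (-k - 1) _ hx).2
    rw [sub_add_cancel, hT.apply (hI.mem hx _)] at this
    rw [this]; ring

/-- To the left of each point, every integer iterate of `T` is locally the translation which
takes the point to its image under the corresponding iterate of the dual map. -/
lemma eventually_zIter_left (ha : IsProbVec a) (hT : IsLrIET a τ T) (hTt : IslRIET a τ Tt)
    (hP : IsZIterLr T P) (hPt : IsZIterlR Tt Pt) (hI : IsItin a P I)
    (hIt : IsItinDual a Pt It) {x : ℝ} (hx : x ∈ Ioc (0 : ℝ) 1) (k : ℤ) :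
    ∀ᶠ y in 𝓝[<] x, y ∈ Ico (0 : ℝ) 1 ∧ P k y = Pt k x + (y - x) := by
  have hroom : ∀ k : ℤ, ∀ᶠ y in 𝓝[<] x, Pt k x + (y - x) ∈ Jint a (It x k) := fun k => by
    have hk := hIt.mem hx k
    have h1 : ∀ᶠ y in 𝓝[<] x, y ∈ Ico (x - (Pt k x - bpt a (It x k : ℕ))) x :=
      Ico_mem_nhdsLT (by linarith [hk.1])
    filter_upwards [h1] with y hy
    exact ⟨by linarith [hy.1], by linarith [hk.2, hy.2]⟩
  induction k using Int.induction_on with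
  | zero =>
    filter_upwards [Ico_mem_nhdsLT hx.1] with y hy
    have : y ∈ Ico (0 : ℝ) 1 := ⟨hy.1, hy.2.trans_le hx.2⟩
    exact ⟨this, by rw [hP.1 _ this, hPt.1 _ hx]; ring⟩
  | succ k ih =>
    filter_upwards [ih, hroom k] with y ⟨hy, h⟩ hr
    refine ⟨hy, ?_⟩
    rw [(hP.2 _ _ hy).2, (hPt.2 _ _ hx).2, h, hT.apply hr, hTt.apply (hIt.mem hx _)]
    ring
  | pred k ih =>
    filter_upwards [ih, hroom (-k - 1)] with y ⟨hy, h⟩ hr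
    refine ⟨hy, injOn_Lr ha hT hP hI (hP.2 _ _ hy).1 (Jint_subset ha _ hr) ?_⟩
    rw [← (hP.2 _ _ hy).2, sub_add_cancel, h, hT.apply hr]
    have := (hPt.2 (-k - 1) _ hx).2
    rw [sub_add_cancel, hTt.apply (hIt.mem hx _)] at this
    rw [this]; ring

lemma eventually_itin_right (ha : IsProbVec a) (hT : IsLrIET a τ T) (hP : IsZIterLr T P)
    (hI : IsItin a P I) {x : ℝ} (hx : x ∈ Ico (0 : ℝ) 1) (k : ℤ) :
    ∀ᶠ y in 𝓝[≥] x, I y k = I x k := by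
  have hk := hI.mem hx k
  have h1 : ∀ᶠ y in 𝓝[≥] x, y ∈ Ico x (x + (bpt a ((I x k : ℕ) + 1) - P k x)) :=
    Ico_mem_nhdsGE (by linarith [hk.2])
  filter_upwards [eventually_zIter_right ha hT hP hI hx k, h1] with y ⟨hy, h⟩ hy1
  rw [hI y hy, h]
  exact ⟨by linarith [hk.1, hy1.1], by linarith [hy1.2]⟩

lemma eventually_itin_left (ha : IsProbVec a) (hT : IsLrIET a τ T) (hTt : IslRIET a τ Tt)
    (hP : IsZIterLr T P) (hPt : IsZIterlR Tt Pt) (hI : IsItin a P I)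
    (hIt : IsItinDual a Pt It) {x : ℝ} (hx : x ∈ Ioc (0 : ℝ) 1) (k : ℤ) :
    ∀ᶠ y in 𝓝[<] x, I y k = It x k := by
  have hk := hIt.mem hx k
  have h1 : ∀ᶠ y in 𝓝[<] x, y ∈ Ico (x - (Pt k x - bpt a (It x k : ℕ))) x :=
    Ico_mem_nhdsLT (by linarith [hk.1])
  filter_upwards [eventually_zIter_left ha hT hTt hP hPt hI hIt hx k, h1] with y ⟨hy, h⟩ hy1
  rw [hI y hy, h]
  exact ⟨by linarith [hy1.1], by linarith [hk.2, hy1.2]⟩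

/-- Every point of the closure of the regular itineraries is an itinerary of `T` or of its
dual. -/
lemma eq_itin_of_mem_closure (ha : IsProbVec a) (hT : IsLrIET a τ T) (hTt : IslRIET a τ Tt)
    (hP : IsZIterLr T P) (hPt : IsZIterlR Tt Pt) (hI : IsItin a P I)
    (hIt : IsItinDual a Pt It) {α : ℤ → Fin n} (hα : α ∈ closure (I '' Rset a P)) :
    (∃ x ∈ Ico (0 : ℝ) 1, α = I x) ∨ ∃ x ∈ Ioc (0 : ℝ) 1, α = It x := by
  obtain ⟨U, hU, hUα⟩ := mem_closure_iff_ultrafilter.1 hα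
  have hne := Filter.comap_inf_principal_neBot_of_image_mem U.neBot hU
  let V := Ultrafilter.of (comap I U ⊓ 𝓟 (Rset a P))
  have hVle : (V : Filter ℝ) ≤ comap I U ⊓ 𝓟 (Rset a P) := Ultrafilter.of_le _
  have hV : Rset a P ∈ V := Filter.le_principal_iff.1 (hVle.trans inf_le_right)
  have hIcc : Icc (0 : ℝ) 1 ∈ V := Filter.mem_of_superset hV fun y hy => hy.1
  obtain ⟨x, hx, hVx⟩ := isCompact_Icc.ultrafilter_le_nhds' V hIcc
  have hcoord : ∀ k : ℤ, ∀ᶠ y in (V : Filter ℝ), I y k = α k := fun k => by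
    have h1 : Tendsto I V (𝓝 α) :=
      (Filter.tendsto_iff_comap.2 (hVle.trans inf_le_left)).mono_right hUα
    have h2 := (continuous_apply k).continuousAt.tendsto.comp h1
    exact h2.eventually (eventually_nhds_iff.2 ⟨{α k}, fun _ h => h, isOpen_discrete _, rfl⟩)
  by_cases hside : Ici x ∈ V
  · left
    have hle : (V : Filter ℝ) ≤ 𝓝[≥] x := le_inf hVx (Filter.le_principal_iff.2 hside)
    have hx1 : x ∈ Ico (0 : ℝ) 1 := by
      obtain ⟨y, hy1, hy2⟩ := V.nonempty_of_mem (Filter.inter_mem hside hV)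
      refine ⟨hx.1, lt_of_le_of_ne hx.2 fun h => hy2.2 (Or.inl (Or.inr ?_))⟩
      exact le_antisymm hy2.1.2 (h ▸ hy1)
    refine ⟨x, hx1, funext fun k => ?_⟩
    obtain ⟨y, hy1, hy2⟩ := ((hcoord k).and
      (hle (eventually_itin_right ha hT hP hI hx1 k))).exists
    exact hy1.symm.trans hy2
  · right
    have hside' : Iio x ∈ V := by
      rw [← compl_Ici]; exact Ultrafilter.compl_mem_iff_notMem.2 hside
    have hle : (V : Filter ℝ) ≤ 𝓝[<] x := le_inf hVx (Filter.le_principal_iff.2 hside')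
    have hx1 : x ∈ Ioc (0 : ℝ) 1 := by
      obtain ⟨y, hy1, hy2⟩ := V.nonempty_of_mem (Filter.inter_mem hside' hV)
      exact ⟨hy2.1.1.trans_lt hy1, hx.2⟩
    refine ⟨x, hx1, funext fun k => ?_⟩
    obtain ⟨y, hy1, hy2⟩ := ((hcoord k).and
      (hle (eventually_itin_left ha hT hTt hP hPt hI hIt hx1 k))).exists
    exact hy1.symm.trans hy2

/-- By irreducibility, `0` is the image of a division point. -/
lemma exists_mem_Dset_map_eq_zero (hn : 2 ≤ n) (ha : IsProbVec a) (hT : IsLrIET a τ T)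
    (hirr : IrreduciblePerm τ) : ∃ d ∈ Dset a, T d = 0 := by
  set z : Fin n := ⟨0, by omega⟩ with hz
  have hne : τ.symm z ≠ z := fun h => by
    have hτ : τ z = z := by rw [← h, Equiv.apply_symm_apply, h]
    refine hirr 1 one_pos (by omega) ?_
    have : {i : Fin n | (i : ℕ) < 1} = {z} := by
      ext i
      simp [hz, Fin.ext_iff]
    rw [this, image_singleton, hτ]
  refine ⟨bpt a (τ.symm z : ℕ), ⟨_, Nat.pos_of_ne_zero fun h => hne (Fin.ext h),
    (τ.symm z).isLt, rfl⟩, ?_⟩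
  rw [hT (τ.symm z) _ ⟨le_rfl, ?_⟩]
  · simp [hz, bpt_zero]
  · rw [bpt_succ]; linarith [ha.1 (τ.symm z)]

lemma Dset_subset (ha : IsProbVec a) : Dset a ⊆ Ioo 0 1 := by
  rintro _ ⟨k, h0, hk, rfl⟩
  exact bpt_mem_Ioo ha h0 hk

lemma KeaneCond.iterate_notMem (hKeane : KeaneCond a T) {d : ℝ} (hd : d ∈ Dset a) {k : ℕ}
    (hk : 0 < k) : T^[k] d ∉ Dset a := fun h =>
  (hKeane k hk).subset ⟨h, mem_image_of_mem _ hd⟩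

/-- Left endpoints of the exchanged intervals never return to `D`. -/
lemma iterate_left_endpoint_notMem (hn : 2 ≤ n) (ha : IsProbVec a) (hT : IsLrIET a τ T)
    (hirr : IrreduciblePerm τ) (hKeane : KeaneCond a T) (i : Fin n) {k : ℕ} (hk : 0 < k) :
    T^[k] (bpt a i) ∉ Dset a := by
  rcases Nat.eq_zero_or_pos (i : ℕ) with h | h
  · obtain ⟨d, hd, hd0⟩ := exists_mem_Dset_map_eq_zero hn ha hT hirr
    rw [h, bpt_zero, ← hd0, ← Function.iterate_succ_apply]
    exact hKeane.iterate_notMem hd (Nat.succ_pos k)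
  · exact hKeane.iterate_notMem ⟨i, h, i.isLt, rfl⟩ hk

/-- An irreducible interval exchange with the Keane condition has no periodic points. -/
lemma iterate_ne_self (hn : 2 ≤ n) (ha : IsProbVec a) (hT : IsLrIET a τ T)
    (hP : IsZIterLr T P) (hI : IsItin a P I) (hirr : IrreduciblePerm τ)
    (hKeane : KeaneCond a T) {x : ℝ} (hx : x ∈ Ico (0 : ℝ) 1) {j : ℕ} (hj : 0 < j) :
    T^[j] x ≠ x := by
  intro hper
  have hmaps := mapsTo_Lr hP
  have horb : ∀ l, T^[l] x ∈ Ico (0 : ℝ) 1 := fun l => hmaps.iterate l hx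
  choose c hc using fun l => exists_mem_Jint hP hI (horb l)
  obtain ⟨m, hm, hmin⟩ := Finset.exists_min_image (Finset.range j)
    (fun l => T^[l] x - bpt a (c l)) ⟨0, by simpa using hj⟩
  set s := T^[m] x - bpt a (c m) with hs
  have hs0 : 0 ≤ s := by linarith [(hc m).1]
  have hmj : m < j := Finset.mem_range.1 hm
  have hslide : ∀ l, l ≤ j → T^[l] (x - s) = T^[l] x - s := by
    intro l
    induction l with
    | zero => simp
    | succ l ih =>
      intro hl
      have h1 : T^[l] x - s ∈ Jint a (c l) :=
        ⟨by linarith [hmin l (Finset.mem_range.2 hl)], by linarith [(hc l).2]⟩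
      rw [Function.iterate_succ_apply', Function.iterate_succ_apply', ih (by omega),
        hT.apply h1, hT.apply (hc l)]
      ring
  have hperiod : T^[j] (bpt a (c m)) = bpt a (c m) := by
    have h1 : bpt a (c m) = T^[m] (x - s) := by rw [hslide m hmj.le, hs]; ring
    rw [h1, ← Function.iterate_add_apply, add_comm, Function.iterate_add_apply,
      hslide j le_rfl, hper]
  rcases Nat.eq_zero_or_pos (c m : ℕ) with h | h
  · obtain ⟨d, hd, hd0⟩ := exists_mem_Dset_map_eq_zero hn ha hT hirr
    obtain ⟨j, rfl⟩ := Nat.exists_eq_succ_of_ne_zero hj.ne'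
    rw [h, bpt_zero, Function.iterate_succ_apply'] at hperiod
    have hd' := Dset_subset ha hd
    have : T^[j] 0 = d := injOn_Lr ha hT hP hI (hmaps.iterate j ⟨le_rfl, one_pos⟩)
      ⟨hd'.1.le, hd'.2⟩ (hperiod.trans hd0.symm)
    refine hKeane.iterate_notMem hd hj ?_
    rwa [Function.iterate_succ_apply, hd0, this]
  · exact hKeane.iterate_notMem ⟨_, h, (c m).isLt, rfl⟩ hj
      (hperiod.symm ▸ (⟨_, h, (c m).isLt, rfl⟩ : bpt a (c m) ∈ Dset a))

/-- There is no nondegenerate interval all of whose preimages avoid the division points. -/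
lemma no_backward_wandering_interval (hn : 2 ≤ n) (ha : IsProbVec a) (hT : IsLrIET a τ T)
    (hP : IsZIterLr T P) (hI : IsItin a P I) (hirr : IrreduciblePerm τ)
    (hKeane : KeaneCond a T) {w : ℝ} (hw : 0 < w) {y : ℕ → ℝ} {c : ℕ → Fin n}
    (hleft : ∀ k, bpt a (c k) ≤ y k) (hright : ∀ k, y k + w ≤ bpt a ((c k : ℕ) + 1))
    (hstep : ∀ k, y k = y (k + 1) + disp a τ (c (k + 1))) : False := by
  have hmem : ∀ k t, t ∈ Ioo 0 w → y k + t ∈ Jint a (c k) := fun k t ht =>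
    ⟨by linarith [hleft k, ht.1], by linarith [hright k, ht.2]⟩
  have hiter : ∀ j k t, t ∈ Ioo 0 w → T^[j] (y (k + j) + t) = y k + t := by
    intro j
    induction j with
    | zero => simp
    | succ j ih =>
      intro k t ht
      rw [Function.iterate_succ_apply, ← add_assoc, hT.apply (hmem _ t ht)]
      have := hstep (k + j)
      rw [← ih k t ht, this]
      congr 1; ring
  have hbdd : ∀ k, y k ∈ Icc (0 : ℝ) 1 := fun k =>
    ⟨(bpt_nonneg ha _).trans (hleft k), by linarith [hright k, bpt_succ_le_one ha (c k)]⟩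
  obtain ⟨k, j, hj, hclose⟩ : ∃ k j : ℕ, 0 < j ∧ |y (k + j) - y k| < w := by
    obtain ⟨x, -, φ, hφ, hlim⟩ := isCompact_Icc.tendsto_subseq hbdd
    obtain ⟨N, hN⟩ := Metric.cauchySeq_iff'.1 hlim.cauchySeq w hw
    have h1 := hN (N + 1) (by omega)
    have h2 : φ N < φ (N + 1) := hφ (Nat.lt_succ_self N)
    refine ⟨φ N, φ (N + 1) - φ N, by omega, ?_⟩
    rwa [Nat.add_sub_cancel' h2.le, ← Real.dist_eq]
  have hinj : InjOn T^[j] (Ico 0 1) := (injOn_Lr ha hT hP hI).iterate (mapsTo_Lr hP) j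
  set v := y (k + j) - y k with hv
  have hprog : ∀ l : ℕ, y (k + (l + 1) * j) - y (k + l * j) = v := by
    intro l
    induction l with
    | zero => simp [hv]
    | succ l ih =>
      obtain ⟨h1, h2⟩ := abs_lt.1 hclose
      obtain ⟨t, ht, hs⟩ : ∃ t, t ∈ Ioo 0 w ∧ t - v ∈ Ioo 0 w := by
        rcases le_total 0 v with h | h
        · exact ⟨(v + w) / 2, ⟨by linarith, by linarith⟩, by linarith, by linarith⟩
        · exact ⟨(v + w) / 2, ⟨by linarith, by linarith⟩, by linarith, by linarith⟩
      have e1 := hiter j (k + l * j) t ht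
      have e2 := hiter j (k + (l + 1) * j) (t - v) hs
      have e3 := hinj (Jint_subset ha _ (hmem _ t ht)) (Jint_subset ha _ (hmem _ _ hs))
        (e1.trans ((by linarith : _ = _).trans e2.symm))
      rw [show k + (l + 1 + 1) * j = k + (l + 1) * j + j by ring]
      rw [show k + l * j + j = k + (l + 1) * j by ring] at e3
      linarith
  have hlin : ∀ l : ℕ, y (k + l * j) = y k + l * v := by
    intro l
    induction l with
    | zero => simp
    | succ l ih => push_cast; linarith [hprog l]
  have hv0 : v = 0 := by
    by_contra hne
    obtain ⟨l, hl⟩ := exists_nat_gt (1 / |v|)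
    have h1 : 1 < l * |v| := (div_lt_iff₀ (abs_pos.2 hne)).1 hl
    have h2 : |l * v| ≤ 1 := by
      rw [show l * v = y (k + l * j) - y k by rw [hlin]; ring, abs_le]
      constructor <;> linarith [(hbdd (k + l * j)).1, (hbdd (k + l * j)).2, (hbdd k).1, (hbdd k).2]
    rw [abs_mul, Nat.abs_cast] at h2
    linarith
  have hhalf : w / 2 ∈ Ioo 0 w := ⟨by linarith, by linarith⟩
  refine iterate_ne_self hn ha hT hP hI hirr hKeane (Jint_subset ha _ (hmem k _ hhalf)) hj ?_
  have := hiter j k _ hhalf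
  rwa [show y (k + j) = y k by linarith] at this

/-- A bi-infinite sequence of positions compatible with a symbolic sequence: each position lies
in the closed interval of its symbol and moves by the corresponding displacement. -/
def IsCodedBy (a : Fin n → ℝ) (τ : Equiv.Perm (Fin n)) (p : ℤ → ℝ) (α : ℤ → Fin n) : Prop :=
  ∀ k, p k ∈ Icc (bpt a (α k)) (bpt a ((α k : ℕ) + 1)) ∧ p (k + 1) = p k + disp a τ (α k)

lemma isCodedBy_itin (hT : IsLrIET a τ T) (hP : IsZIterLr T P) (hI : IsItin a P I) {x : ℝ}
    (hx : x ∈ Ico (0 : ℝ) 1) : IsCodedBy a τ (fun k => P k x) (I x) := fun k =>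
  have h := hI.mem hx k
  ⟨⟨h.1, h.2.le⟩, by simp only [(hP.2 k x hx).2, hT.apply h]⟩

lemma isCodedBy_itinDual (hTt : IslRIET a τ Tt) (hPt : IsZIterlR Tt Pt)
    (hIt : IsItinDual a Pt It) {x : ℝ} (hx : x ∈ Ioc (0 : ℝ) 1) :
    IsCodedBy a τ (fun k => Pt k x) (It x) := fun k =>
  have h := hIt.mem hx k
  ⟨⟨h.1.le, h.2⟩, by simp only [(hPt.2 k x hx).2, hTt.apply h]⟩

lemma IsCodedBy.not_lt (hn : 2 ≤ n) (ha : IsProbVec a) (hT : IsLrIET a τ T)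
    (hP : IsZIterLr T P) (hI : IsItin a P I) (hirr : IrreduciblePerm τ)
    (hKeane : KeaneCond a T) {p q : ℤ → ℝ} {α β : ℤ → Fin n} (hp : IsCodedBy a τ p α)
    (hq : IsCodedBy a τ q β) {m : ℤ} (h : ∀ k < m, α k = β k) : ¬ p m < q m := by
  intro hlt
  have hdiff : ∀ k : ℕ, q (m - k) - p (m - k) = q m - p m := by
    intro k
    induction k with
    | zero => simp
    | succ k ih =>
      have h1 := (hp (m - (k + 1 : ℕ))).2
      have h2 := (hq (m - (k + 1 : ℕ))).2
      rw [← h _ (by omega)] at h2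
      rw [show m - ((k + 1 : ℕ) : ℤ) + 1 = m - k by push_cast; ring] at h1 h2
      linarith
  refine no_backward_wandering_interval hn ha hT hP hI hirr hKeane (sub_pos.2 hlt)
    (y := fun k => p (m - (k + 1 : ℕ))) (c := fun k => α (m - (k + 1 : ℕ)))
    (fun k => (hp _).1.1) (fun k => ?_) fun k => ?_
  · have h1 := (hq (m - (k + 1 : ℕ))).1.2
    rw [← h _ (by omega)] at h1
    linarith [hdiff (k + 1)]
  · have h1 := (hp (m - (k + 1 + 1 : ℕ))).2
    rwa [show m - ((k + 1 + 1 : ℕ) : ℤ) + 1 = m - (k + 1 : ℕ) by push_cast; ring] at h1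

/-- The past of a coding determines the position. -/
lemma IsCodedBy.eq_of_past (hn : 2 ≤ n) (ha : IsProbVec a) (hT : IsLrIET a τ T)
    (hP : IsZIterLr T P) (hI : IsItin a P I) (hirr : IrreduciblePerm τ)
    (hKeane : KeaneCond a T) {p q : ℤ → ℝ} {α β : ℤ → Fin n} (hp : IsCodedBy a τ p α)
    (hq : IsCodedBy a τ q β) {m : ℤ} (h : ∀ k < m, α k = β k) : p m = q m :=
  le_antisymm (le_of_not_gt (hq.not_lt hn ha hT hP hI hirr hKeane hp fun k hk => (h k hk).symm))
    (le_of_not_gt (hp.not_lt hn ha hT hP hI hirr hKeane hq h))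

lemma eq_bpt_of_mem_of_mem (ha : IsProbVec a) {i j : Fin n} {u : ℝ} (hi : u ∈ Jint a i)
    (hj : u ∈ Jtil a j) (hij : i ≠ j) : 0 < (i : ℕ) ∧ u = bpt a i := by
  rcases lt_or_gt_of_ne (fun h => hij (Fin.ext h) : (i : ℕ) ≠ j) with h | h
  · have : bpt a ((i : ℕ) + 1) ≤ bpt a j := bpt_mono ha.1 h
    linarith [hi.2, hj.1]
  · have : bpt a ((j : ℕ) + 1) ≤ bpt a i := bpt_mono ha.1 h
    exact ⟨by omega, by linarith [hi.1, hj.2]⟩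

/-- If an itinerary of `T` and one of the dual map agree before time `m` but not at `m`, then they
are the itineraries of a common division point, shifted by `-m`. -/
lemma pair_eq_of_past (hn : 2 ≤ n) (ha : IsProbVec a) (hT : IsLrIET a τ T)
    (hTt : IslRIET a τ Tt) (hP : IsZIterLr T P) (hPt : IsZIterlR Tt Pt) (hI : IsItin a P I)
    (hIt : IsItinDual a Pt It) (hirr : IrreduciblePerm τ) (hKeane : KeaneCond a T) {x z : ℝ}
    (hx : x ∈ Ico (0 : ℝ) 1) (hz : z ∈ Ioc (0 : ℝ) 1) {m : ℤ} (h : ∀ k < m, I x k = It z k)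
    (hm : I x m ≠ It z m) : ∃ i : ℕ, 0 < i ∧ i < n ∧ ∃ k : ℤ,
      I x = shiftZ k (I (bpt a i)) ∧ It z = shiftZ k (It (bpt a i)) := by
  have hpos : P m x = Pt m z := (isCodedBy_itin hT hP hI hx).eq_of_past hn ha hT hP hI hirr hKeane
    (isCodedBy_itinDual hTt hPt hIt hz) h
  obtain ⟨h0, hu⟩ := eq_bpt_of_mem_of_mem ha (hI.mem hx m) (hpos ▸ hIt.mem hz m) hm
  refine ⟨I x m, h0, (I x m).isLt, -m, ?_, ?_⟩
  · rw [← hu, itin_shift ha hT hP hI hx]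
  · rw [← hu, hpos, itinDual_shift ha hTt hPt hIt hz]

lemma iterate_zIter (hP : IsZIterLr T P) {x : ℝ} (hx : x ∈ Ico (0 : ℝ) 1) (j : ℕ) (k : ℤ) :
    T^[j] (P k x) = P (k + j) x := by
  induction j with
  | zero => simp
  | succ j ih =>
    rw [Function.iterate_succ_apply', ih, ← (hP.2 _ x hx).2]
    congr 1; push_cast; ring

/-- The two itineraries of a division point agree at negative times. -/
lemma itin_eq_itinDual_of_neg (hn : 2 ≤ n) (ha : IsProbVec a) (hT : IsLrIET a τ T)
    (hTt : IslRIET a τ Tt) (hP : IsZIterLr T P) (hPt : IsZIterlR Tt Pt) (hI : IsItin a P I)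
    (hIt : IsItinDual a Pt It) (hirr : IrreduciblePerm τ) (hKeane : KeaneCond a T) {b : ℝ}
    (hb : b ∈ Dset a) {k : ℤ} (hk : k < 0) : I b k = It b k := by
  have hb' := Dset_subset ha hb
  have hbL : b ∈ Ico (0 : ℝ) 1 := ⟨hb'.1.le, hb'.2⟩
  have hbR : b ∈ Ioc (0 : ℝ) 1 := ⟨hb'.1, hb'.2.le⟩
  have hint : ∀ j : ℕ, P (-(j + 1 : ℕ)) b ∈ Jtil a (I b (-(j + 1 : ℕ))) := by
    intro j
    have h := hI.mem hbL (-(j + 1 : ℕ))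
    refine ⟨lt_of_le_of_ne h.1 fun heq => ?_, h.2.le⟩
    refine iterate_left_endpoint_notMem hn ha hT hirr hKeane (I b (-(j + 1 : ℕ)))
      (Nat.succ_pos j) ?_
    rw [heq, Nat.succ_eq_add_one, iterate_zIter hP hbL, neg_add_cancel, hP.1 b hbL]
    exact hb
  have heq : ∀ j : ℕ, P (-(j : ℤ)) b = Pt (-(j : ℤ)) b := by
    intro j
    induction j with
    | zero => simp [hP.1 b hbL, hPt.1 b hbR]
    | succ j ih =>
      refine injOn_lR ha hTt hPt hIt (Jtil_subset ha _ (hint j)) (hPt.2 _ b hbR).1 ?_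
      rw [← (hPt.2 _ b hbR).2, hTt.apply (hint j), ← hT.apply (hI.mem hbL _), ← (hP.2 _ b hbL).2]
      rw [show -((j + 1 : ℕ) : ℤ) + 1 = -j by push_cast; ring, ih]
  obtain ⟨j, rfl⟩ : ∃ j : ℕ, k = -(j + 1 : ℕ) := ⟨(-k - 1).toNat, by omega⟩
  exact ((hIt b hbR _ _).2 (heq (j + 1) ▸ hint j)).symm

lemma NegAsymp.symm {α β : ℤ → Fin n} (h : NegAsymp α β) : NegAsymp β α :=
  h.imp fun _ hN i hi => (hN i hi).symm

end Coding

/-- Theorem 4.5 (ii): under irreducibility and the Keane Condition,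
distinct `α, β ∈ X` form a negatively asymptotic pair iff there are `i ∈ {1,…,n-1}`
and `k ∈ ℤ` such that, with `x = b_i ∈ D`, `{α, β} = {S^k 𝓘(x), S^k 𝓘̃(x)}`. -/
theorem stmt16 {n : ℕ} (hn : 2 ≤ n) (a : Fin n → ℝ) (ha : IsProbVec a)
    (τ : Equiv.Perm (Fin n)) (T Tt : ℝ → ℝ)
    (hT : IsLrIET a τ T) (hTt : IslRIET a τ Tt)
    (P Pt : ℤ → ℝ → ℝ) (hP : IsZIterLr T P) (hPt : IsZIterlR Tt Pt)
    (I It : ℝ → ℤ → Fin n) (hI : IsItin a P I) (hIt : IsItinDual a Pt It)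
    (hirr : IrreduciblePerm τ) (hKeane : KeaneCond a T)
    (α β : ℤ → Fin n) (hα : α ∈ closure (I '' Rset a P))
    (hβ : β ∈ closure (I '' Rset a P)) (hne : α ≠ β) :
    NegAsymp α β ↔
      ∃ i : ℕ, 0 < i ∧ i < n ∧ ∃ k : ℤ,
        ({α, β} : Set (ℤ → Fin n)) =
          {shiftZ k (I (bpt a i)), shiftZ k (It (bpt a i))} := by
  constructor
  · rintro ⟨N, hN⟩
    obtain ⟨m, hm, hmin⟩ : ∃ m : ℤ, α m ≠ β m ∧ ∀ k < m, α k = β k := by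
      obtain ⟨m, hm, hmin⟩ := Int.exists_least_of_bdd (P := fun m => α m ≠ β m)
        ⟨-N, fun z hz => le_of_not_ge fun h => hz (hN z h)⟩ (Function.ne_iff.1 hne)
      exact ⟨m, hm, fun k hk => by_contra fun h => (hmin k h).not_gt hk⟩
    rcases eq_itin_of_mem_closure ha hT hTt hP hPt hI hIt hα with ⟨x, hx, rfl⟩ | ⟨x, hx, rfl⟩ <;>
      rcases eq_itin_of_mem_closure ha hT hTt hP hPt hI hIt hβ with ⟨z, hz, rfl⟩ | ⟨z, hz, rfl⟩
    · have h : P m x = P m z := (isCodedBy_itin hT hP hI hx).eq_of_past hn ha hT hP hI hirr hKeane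
        (isCodedBy_itin hT hP hI hz) hmin
      exact absurd ((hI x hx m _).2 (h ▸ hI.mem hz m)) hm
    · obtain ⟨i, h0, hi, k, h1, h2⟩ :=
        pair_eq_of_past hn ha hT hTt hP hPt hI hIt hirr hKeane hx hz hmin hm
      exact ⟨i, h0, hi, k, by rw [← h1, ← h2]⟩
    · obtain ⟨i, h0, hi, k, h1, h2⟩ := pair_eq_of_past hn ha hT hTt hP hPt hI hIt hirr hKeane hz hx
        (fun k hk => (hmin k hk).symm) hm.symm
      exact ⟨i, h0, hi, k, by rw [← h1, ← h2, Set.pair_comm]⟩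
    · have h : Pt m x = Pt m z := (isCodedBy_itinDual hTt hPt hIt hx).eq_of_past hn ha hT hP hI hirr
        hKeane (isCodedBy_itinDual hTt hPt hIt hz) hmin
      exact absurd ((hIt x hx m _).2 (h ▸ hIt.mem hz m)) hm
  · rintro ⟨i, h0, hi, k, hpair⟩
    have h : NegAsymp (shiftZ k (I (bpt a i))) (shiftZ k (It (bpt a i))) :=
      ⟨(k + 1).toNat, fun l hl => itin_eq_itinDual_of_neg hn ha hT hTt hP hPt hI hIt hirr hKeane
        ⟨i, h0, hi, rfl⟩ (by omega)⟩
    rcases Set.pair_eq_pair_iff.1 hpair with ⟨rfl, rfl⟩ | ⟨rfl, rfl⟩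
    · exact h
    · exact h.symm
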